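/- arXiv:2206.09129 — 2 statements merged into one kernel-verified Lean document; each statement's English description precedes it below -/
import Mathlib

section
/- Let n ≥ 2 and let X be an alphabet. Every monoid identity w = w' over X that holds in the stylic monoid Styl_n also holds in the Catalan monoid Cat_n. -/
/-- Defining relations of the stylic monoid `Styl_n` (Abram–Reutenauer presentation):
`a_i² = a_i`; `a_j a_i a_k = a_j a_k a_i` and `a_i a_k a_j = a_k a_i a_j` for `i < j < k`;
`a_j a_i a_i = a_i a_j a_i` and `a_j a_j a_i = a_j a_i a_j` for `i < j`. -/
def stylRel (n : ℕ) : FreeMonoid (Fin n) → FreeMonoid (Fin n) → Prop := fun u v =>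
  (∃ i : Fin n, u = .of i * .of i ∧ v = .of i) ∨
  (∃ i j k : Fin n, i < j ∧ j < k ∧ u = .of j * .of i * .of k ∧ v = .of j * .of k * .of i) ∨
  (∃ i j k : Fin n, i < j ∧ j < k ∧ u = .of i * .of k * .of j ∧ v = .of k * .of i * .of j) ∨
  (∃ i j : Fin n, i < j ∧ u = .of j * .of i * .of i ∧ v = .of i * .of j * .of i) ∨
  (∃ i j : Fin n, i < j ∧ u = .of j * .of j * .of i ∧ v = .of j * .of i * .of j)

/-- The stylic monoid on `n` generators. -/
abbrev Styl (n : ℕ) := PresentedMonoid (stylRel n)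

/-- The `i`-th generator of the stylic monoid. -/
def stylGen (n : ℕ) (i : Fin n) : Styl n := PresentedMonoid.of (stylRel n) i

/-- Defining relations of the Catalan monoid `Cat_n` (Solomon's presentation):
`a_i² = a_i`; `a_i a_k = a_k a_i` if `|i − k| ≥ 2`;
`a_i a_{i+1} a_i = a_{i+1} a_i` and `a_{i+1} a_i a_{i+1} = a_{i+1} a_i`. -/
def catRel (n : ℕ) : FreeMonoid (Fin n) → FreeMonoid (Fin n) → Prop := fun u v =>
  (∃ i : Fin n, u = .of i * .of i ∧ v = .of i) ∨
  (∃ i k : Fin n, ((i : ℕ) + 2 ≤ (k : ℕ) ∨ (k : ℕ) + 2 ≤ (i : ℕ)) ∧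
    u = .of i * .of k ∧ v = .of k * .of i) ∨
  (∃ i j : Fin n, (i : ℕ) + 1 = (j : ℕ) ∧ u = .of i * .of j * .of i ∧ v = .of j * .of i) ∨
  (∃ i j : Fin n, (i : ℕ) + 1 = (j : ℕ) ∧ u = .of j * .of i * .of j ∧ v = .of j * .of i)

/-- The Catalan monoid on `n` generators. -/
abbrev Cat (n : ℕ) := PresentedMonoid (catRel n)

/-- The `i`-th generator of the Catalan monoid. -/
def catGen (n : ℕ) (i : Fin n) : Cat n := PresentedMonoid.of (catRel n) i

theorem catGen_idem (n : ℕ) (i : Fin n) : catGen n i * catGen n i = catGen n i :=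
  Quotient.sound (ConGen.Rel.of _ _ (Or.inl ⟨i, rfl, rfl⟩))

theorem catGen_comm (n : ℕ) (i k : Fin n)
    (h : (i : ℕ) + 2 ≤ (k : ℕ) ∨ (k : ℕ) + 2 ≤ (i : ℕ)) :
    catGen n i * catGen n k = catGen n k * catGen n i :=
  Quotient.sound (ConGen.Rel.of _ _ (Or.inr (Or.inl ⟨i, k, h, rfl, rfl⟩)))

theorem catGen_iji (n : ℕ) (i j : Fin n) (h : (i : ℕ) + 1 = (j : ℕ)) :
    catGen n i * catGen n j * catGen n i = catGen n j * catGen n i :=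
  Quotient.sound (ConGen.Rel.of _ _ (Or.inr (Or.inr (Or.inl ⟨i, j, h, rfl, rfl⟩))))

theorem catGen_jij (n : ℕ) (i j : Fin n) (h : (i : ℕ) + 1 = (j : ℕ)) :
    catGen n j * catGen n i * catGen n j = catGen n j * catGen n i :=
  Quotient.sound (ConGen.Rel.of _ _ (Or.inr (Or.inr (Or.inr ⟨i, j, h, rfl, rfl⟩))))

/-- The stylic relations hold in the Catalan monoid. -/
theorem stylRel_cat (n : ℕ) (u v : FreeMonoid (Fin n)) (h : stylRel n u v) :
    FreeMonoid.lift (catGen n) u = FreeMonoid.lift (catGen n) v := by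
  rcases h with ⟨i, rfl, rfl⟩ | ⟨i, j, k, hij, hjk, rfl, rfl⟩ | ⟨i, j, k, hij, hjk, rfl, rfl⟩ |
    ⟨i, j, hij, rfl, rfl⟩ | ⟨i, j, hij, rfl, rfl⟩ <;>
    simp only [map_mul, FreeMonoid.lift_eval_of]
  · exact catGen_idem n i
  · rw [mul_assoc, mul_assoc, catGen_comm n i k (by omega)]
  · rw [catGen_comm n i k (by omega)]
  · rw [mul_assoc, catGen_idem]
    by_cases hc : (i : ℕ) + 1 = j
    · exact (catGen_iji n i j hc).symm
    · rw [catGen_comm n i j (by omega), mul_assoc, catGen_idem]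
  · rw [catGen_idem]
    by_cases hc : (i : ℕ) + 1 = j
    · exact (catGen_jij n i j hc).symm
    · rw [mul_assoc, catGen_comm n i j (by omega), ← mul_assoc, catGen_idem]

/-- The canonical projection of the stylic monoid onto the Catalan monoid. -/
def stylToCat (n : ℕ) : Styl n →* Cat n :=
  PresentedMonoid.lift (catGen n) (stylRel_cat n)

theorem stylToCat_surjective (n : ℕ) : Function.Surjective (stylToCat n) := by
  intro y
  obtain ⟨u, rfl⟩ := PresentedMonoid.surjective_mk y
  refine ⟨PresentedMonoid.mk (stylRel n) u, ?_⟩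
  have : (stylToCat n).comp (PresentedMonoid.mk (stylRel n)) = PresentedMonoid.mk (catRel n) := by
    apply FreeMonoid.hom_eq
    intro i
    rfl
  exact DFunLike.congr_fun this u

/-- For `n ≥ 2`, every monoid identity `w = w'` holding in the stylic monoid `Styl_n`
also holds in the Catalan monoid `Cat_n`. -/
theorem identity_of_stylic_holds_in_catalan (n : ℕ) (hn : 2 ≤ n) (X : Type*)
    (w w' : FreeMonoid X) (h : ∀ φ : FreeMonoid X →* Styl n, φ w = φ w') :
    ∀ φ : FreeMonoid X →* Cat n, φ w = φ w' := by
  intro φ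
  choose g hg using fun x : X => stylToCat_surjective n (φ (FreeMonoid.of x))
  have key : (stylToCat n).comp (FreeMonoid.lift g) = φ := by
    apply FreeMonoid.hom_eq
    intro x
    simp [hg]
  rw [← key, MonoidHom.comp_apply, MonoidHom.comp_apply, h]
end

section
/- Let n ≥ 2 and let X be an alphabet. If two words w, w' ∈ X* have the same set of scattered subwords of length at most n, then the identity w = w' holds in the stylic monoid Styl_n. -/
namespace StylProof

variable {α : Type*} [LinearOrder α]

/-- Insert `a` into a strictly increasing row. -/
def ins (a : α) (R : List α) : List α :=
  R.filter (fun x => decide (x < a)) ++ a :: R.filter (fun x => decide (a < x))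

/-- The word of bumped letters when inserting the letters of a word into a row. -/
def bump : List α → List α → List α
  | _, [] => []
  | R, a :: u => (R.filter (fun x => decide (a < x))).head?.toList ++ bump (ins a R) u

/-- The final row. -/
def row : List α → List α → List α
  | R, [] => R
  | R, a :: u => row (ins a R) u

theorem mem_ins {a x : α} {R : List α} : x ∈ ins a R ↔ x = a ∨ x ∈ R := by
  unfold ins
  simp only [List.mem_append, List.mem_filter, List.mem_cons, decide_eq_true_eq]
  rcases lt_trichotomy x a with h | h | h
  · have := h.not_gt
    have := h.ne
    tauto
  · tauto
  · have := h.not_gt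
    have := h.ne'
    tauto

theorem sorted_ins {a : α} {R : List α} (h : R.Pairwise (· < ·)) :
    (ins a R).Pairwise (· < ·) := by
  unfold ins
  rw [List.pairwise_append, List.pairwise_cons]
  refine ⟨h.filter _, ⟨by simp, h.filter _⟩, ?_⟩
  intro x hx y hy
  simp only [List.mem_filter, List.mem_cons, decide_eq_true_eq] at hx hy
  rcases hy with rfl | hy
  · exact hx.2
  · exact hx.2.trans hy.2

theorem mem_row {x : α} : ∀ {u R : List α}, x ∈ row R u ↔ x ∈ R ∨ x ∈ u
  | [], R => by simp [row]
  | a :: u, R => by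
    rw [row, mem_row, mem_ins, List.mem_cons]; tauto

theorem sorted_row : ∀ {u R : List α}, R.Pairwise (· < ·) → (row R u).Pairwise (· < ·)
  | [], R, h => h
  | a :: u, R, h => by
    rw [row]; exact sorted_row (sorted_ins h)

theorem sorted_split {a : α} : ∀ {R : List α}, R.Pairwise (· < ·) →
    R = R.filter (fun x => decide (x < a)) ++ ((if a ∈ R then [a] else []) ++
      R.filter (fun x => decide (a < x)))
  | [], _ => by simp
  | c :: R, h => by
    rw [List.pairwise_cons] at h
    have ih := sorted_split (a := a) h.2
    rcases lt_trichotomy c a with hc | hc | hc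
    · have h2 := hc.not_gt
      have h3 := hc.ne'
      simp only [List.filter_cons, hc, h2, List.mem_cons, h3, decide_true, decide_false, if_true,
        false_or, List.cons_append]
      simpa using ih
    · subst hc
      have h1 : R.filter (fun x => decide (x < c)) = [] := by
        rw [List.filter_eq_nil_iff]
        intro x hx
        simpa using (h.1 x hx).le
      have h2 : R.filter (fun x => decide (c < x)) = R := by
        rw [List.filter_eq_self]
        intro x hx
        simpa using h.1 x hx
      simp [h1, h2]
    · have h1 : R.filter (fun x => decide (x < a)) = [] := by
        rw [List.filter_eq_nil_iff]
        intro x hx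
        simpa using (hc.trans (h.1 x hx)).le
      have h2 : R.filter (fun x => decide (a < x)) = R := by
        rw [List.filter_eq_self]
        intro x hx
        simpa using hc.trans (h.1 x hx)
      have h3 : a ∉ R := fun ha => (hc.trans (h.1 a ha)).false
      simp [h1, h2, h3, hc, hc.le, hc.ne]

/-- If some element of the (sorted) row is larger than `a`, the least one gets bumped. -/
theorem head_some {a c : α} {R : List α} (h : R.Pairwise (· < ·)) (hc : c ∈ R) (hac : a < c) :
    ∃ b, (R.filter (fun x => decide (a < x))).head? = some b ∧ a < b ∧ b ≤ c := by
  have hs : (R.filter (fun x => decide (a < x))).Pairwise (· < ·) := h.filter _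
  have hm : c ∈ R.filter (fun x => decide (a < x)) := by simp [hc, hac]
  have hall : ∀ x ∈ R.filter (fun x => decide (a < x)), a < x := by
    intro x hx; simpa using (List.mem_filter.1 hx).2
  generalize R.filter (fun x => decide (a < x)) = F at *
  cases F with
  | nil => simp at hm
  | cons b F =>
    refine ⟨b, rfl, hall b (by simp), ?_⟩
    rw [List.pairwise_cons] at hs
    rcases List.mem_cons.1 hm with rfl | hm
    · exact le_rfl
    · exact (hs.1 c hm).le

theorem head_spec {a b : α} {R : List α} (h : R.Pairwise (· < ·))
    (hb : (R.filter (fun x => decide (a < x))).head? = some b) :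
    b ∈ R ∧ a < b ∧ ∀ c ∈ R, a < c → b ≤ c := by
  have hm := List.mem_of_mem_head? hb
  simp only [List.mem_filter, decide_eq_true_eq] at hm
  refine ⟨hm.1, hm.2, fun c hc hac => ?_⟩
  obtain ⟨b', hb', _, h2⟩ := head_some h hc hac
  rw [hb] at hb'
  cases hb'
  exact h2

theorem mem_bump {x : α} : ∀ {u R : List α}, R.Pairwise (· < ·) → x ∈ bump R u → x ∈ R ∨ x ∈ u
  | [], R, _, hx => by simp [bump] at hx
  | a :: u, R, h, hx => by
    rw [bump, List.mem_append] at hx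
    rcases hx with hx | hx
    · rw [Option.mem_toList] at hx
      exact Or.inl (head_spec h hx).1
    · rcases mem_bump (sorted_ins h) hx with h' | h'
      · rw [mem_ins] at h'
        rw [List.mem_cons]
        tauto
      · exact Or.inr (List.mem_cons_of_mem _ h')

theorem length_bump_le : ∀ (u R : List α), (bump R u).length ≤ u.length
  | [], R => by simp [bump]
  | a :: u, R => by
    rw [bump, List.length_append, List.length_cons]
    have := length_bump_le u (ins a R)
    have h2 : ∀ o : Option α, o.toList.length ≤ 1 := by
      intro o; cases o <;> simp
    have := h2 (R.filter (fun x => decide (a < x))).head?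
    omega

theorem length_bump_lt (a : α) (u : List α) : (bump [] (a :: u)).length < (a :: u).length := by
  have := length_bump_le u (ins a [])
  simp [bump]
  omega

/-- Forward chain lemma. -/
theorem chain_fwd (l : α) : ∀ (u R xs : List α) (x0 : α), R.Pairwise (· < ·) → x0 ∈ R →
    xs.Sublist u → (x0 :: xs).Pairwise (· > ·) → (∀ x ∈ xs, l ≤ x) →
    ∃ ys : List α, ys.Sublist (bump R u) ∧ ys.length = xs.length ∧ ys.Pairwise (· > ·) ∧
      ∀ y ∈ ys, y ≤ x0 ∧ l < y
  | [], R, xs, x0, _, _, hs, _, _ => by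
    have : xs = [] := List.sublist_nil.1 hs
    subst this
    exact ⟨[], by simp⟩
  | a :: u, R, xs, x0, hR, h0, hs, hd, hl => by
    rw [bump]
    rcases List.sublist_cons_iff.1 hs with hs | ⟨xs', rfl, hs'⟩
    · obtain ⟨ys, h1, h2⟩ := chain_fwd l u (ins a R) xs x0 (sorted_ins hR)
        (mem_ins.2 (Or.inr h0)) hs hd hl
      exact ⟨ys, h1.trans (List.sublist_append_right _ _), h2⟩
    · rw [List.pairwise_cons] at hd
      obtain ⟨ys, h1, h2, h3, h4⟩ := chain_fwd l u (ins a R) xs' a (sorted_ins hR)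
        (mem_ins.2 (Or.inl rfl)) hs' hd.2 (fun x hx => hl x (List.mem_cons_of_mem _ hx))
      have ha0 : a < x0 := hd.1 a (by simp)
      obtain ⟨b, hb, hab, hb0⟩ := head_some hR h0 ha0
      refine ⟨b :: ys, ?_, by simp [h2], ?_, ?_⟩
      · rw [hb]; simpa using h1
      · rw [List.pairwise_cons]
        exact ⟨fun y hy => (h4 y hy).1.trans_lt hab, h3⟩
      · intro y hy
        rcases List.mem_cons.1 hy with rfl | hy
        · exact ⟨hb0, (hl a (by simp)).trans_lt hab⟩
        · exact ⟨(h4 y hy).1.trans ha0.le, (h4 y hy).2⟩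

theorem chain_fwd' (l : α) : ∀ (u R xs : List α) (x0 : α), R.Pairwise (· < ·) →
    (x0 :: xs).Sublist u → (x0 :: xs).Pairwise (· > ·) → (∀ x ∈ xs, l ≤ x) →
    ∃ ys : List α, ys.Sublist (bump R u) ∧ ys.length = xs.length ∧ ys.Pairwise (· > ·) ∧
      ∀ y ∈ ys, y ≤ x0 ∧ l < y
  | [], R, xs, x0, _, hs, _, _ => by simp at hs
  | a :: u, R, xs, x0, hR, hs, hd, hl => by
    rw [bump]
    have : ∃ ys : List α, ys.Sublist (bump (ins a R) u) ∧ ys.length = xs.length ∧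
        ys.Pairwise (· > ·) ∧ ∀ y ∈ ys, y ≤ x0 ∧ l < y := by
      rcases List.sublist_cons_iff.1 hs with hs | ⟨xs', he, hs⟩
      · exact chain_fwd' l u (ins a R) xs x0 (sorted_ins hR) hs hd hl
      · cases he
        exact chain_fwd l u (ins a R) xs a (sorted_ins hR) (mem_ins.2 (Or.inl rfl)) hs hd hl
    obtain ⟨ys, h1, h2⟩ := this
    exact ⟨ys, h1.trans (List.sublist_append_right _ _), h2⟩

/-- Backward chain lemma. -/
theorem chain_bwd (i : α) : ∀ (u R ys : List α) (y0 : α), R.Pairwise (· < ·) →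
    (y0 :: ys).Sublist (bump R u) → (y0 :: ys).Pairwise (· > ·) →
    (i ∈ R ∨ i ∈ u) → ((∀ y ∈ y0 :: ys, i < y) ∨ (∀ x ∈ u, i ≤ x)) →
    ∃ zs : List α, ((y0 ∈ R ∧ zs.Sublist u) ∨ (y0 :: zs).Sublist u) ∧
      zs.length = ys.length + 1 ∧ (y0 :: zs).Pairwise (· > ·) ∧ ∀ z ∈ zs, i ≤ z
  | [], R, ys, y0, _, hs, _, _, _ => by simp [bump] at hs
  | a :: u, R, ys, y0, hR, hs, hd, hi, hq => by
    rw [bump] at hs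
    have hi' : i ∈ ins a R ∨ i ∈ u := by
      rw [mem_ins]; rw [List.mem_cons] at hi; tauto
    have skip : (y0 :: ys).Sublist (bump (ins a R) u) → ∃ zs : List α,
        ((y0 ∈ R ∧ zs.Sublist (a :: u)) ∨ (y0 :: zs).Sublist (a :: u)) ∧
        zs.length = ys.length + 1 ∧ (y0 :: zs).Pairwise (· > ·) ∧ ∀ z ∈ zs, i ≤ z := by
      intro hs
      obtain ⟨zs, h1, h2⟩ := chain_bwd i u (ins a R) ys y0 (sorted_ins hR) hs hd hi'
        (hq.imp_right fun h x hx => h x (List.mem_cons_of_mem _ hx))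
      refine ⟨zs, ?_, h2⟩
      rcases h1 with ⟨h1, h3⟩ | h1
      · rcases mem_ins.1 h1 with rfl | h1
        · exact Or.inr (h3.cons_cons _)
        · exact Or.inl ⟨h1, h3.cons _⟩
      · exact Or.inr (h1.cons _)
    cases hb : (R.filter (fun x => decide (a < x))).head? with
    | none =>
      rw [hb] at hs
      exact skip (by simpa using hs)
    | some b =>
      rw [hb] at hs
      obtain ⟨hbR, hab, hmin⟩ := head_spec hR hb
      rw [Option.toList_some, List.singleton_append] at hs
      rcases List.sublist_cons_iff.1 hs with hs | ⟨ys', he, hs⟩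
      · exact skip hs
      · cases he
        cases ys with
        | nil =>
          by_cases hia : i ≤ a
          · exact ⟨[a], Or.inl ⟨hbR, by simp⟩, by simp, by simpa using hab, by simpa using hia⟩
          · have hai : a < i := not_le.1 hia
            have hiy : i < y0 := by
              rcases hq with h | h
              · exact h _ (by simp)
              · exact absurd (h a (by simp)) hia
            have hiu : i ∈ a :: u := by
              rcases hi with h | h
              · exact absurd (hmin i h hai) (not_le.2 hiy)
              · exact h
            exact ⟨[i], Or.inl ⟨hbR, by simpa using hiu⟩, by simp, by simpa using hiy, by simp⟩
        | cons y1 ys =>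
          rw [List.pairwise_cons] at hd
          have h10 : y1 < y0 := hd.1 y1 (by simp)
          obtain ⟨zs, h1, h2, h3, h4⟩ := chain_bwd i u (ins a R) ys y1 (sorted_ins hR) hs hd.2 hi'
            (hq.imp (fun h x hx => h x (List.mem_cons_of_mem _ hx))
              (fun h x hx => h x (List.mem_cons_of_mem _ hx)))
          rw [List.pairwise_cons] at h3
          have hzne : ∃ z, z ∈ zs := by
            cases zs with
            | nil => simp at h2
            | cons z zs => exact ⟨z, by simp⟩
          obtain ⟨z, hz⟩ := hzne
          have hiy1 : i ≤ y1 := (h4 z hz).trans (h3.1 z hz).le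
          have key : ∀ c, y1 ≤ c → c < y0 → (c :: zs).Sublist (a :: u) → ∃ zs : List α,
              ((y0 ∈ R ∧ zs.Sublist (a :: u)) ∨ (y0 :: zs).Sublist (a :: u)) ∧
              zs.length = (y1 :: ys).length + 1 ∧ (y0 :: zs).Pairwise (· > ·) ∧
              ∀ z ∈ zs, i ≤ z := by
            intro c hc hc0 hsub
            refine ⟨c :: zs, Or.inl ⟨hbR, hsub⟩, by simp [h2], ?_, ?_⟩
            · rw [List.pairwise_cons, List.pairwise_cons]
              refine ⟨?_, fun z hz => (h3.1 z hz).trans_le hc, h3.2⟩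
              intro z hz
              rcases List.mem_cons.1 hz with rfl | hz
              · exact hc0
              · exact ((h3.1 z hz).trans_le hc).trans hc0
            · intro z hz
              rcases List.mem_cons.1 hz with rfl | hz
              · exact hiy1.trans hc
              · exact h4 z hz
          rcases h1 with ⟨h1, h5⟩ | h1
          · have hya : y1 ≤ a := by
              rcases mem_ins.1 h1 with rfl | h1
              · exact le_rfl
              · by_contra hlt
                exact absurd (hmin y1 h1 (not_le.1 hlt)) (not_le.2 h10)
            exact key a hya hab (h5.cons_cons _)
          · exact key y1 le_rfl h10 (h1.cons _)

/-- `u` has a strictly decreasing subword of length `m` with letters in `[i,j]`. -/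
def Dec (u : List α) (i j : α) (m : ℕ) : Prop :=
  ∃ xs : List α, xs.Sublist u ∧ xs.length = m ∧ xs.Pairwise (· > ·) ∧ ∀ x ∈ xs, i ≤ x ∧ x ≤ j

theorem dec_zero (u : List α) (i j : α) : Dec u i j 0 := ⟨[], by simp⟩

theorem mem_iff_dec (u : List α) (a : α) : a ∈ u ↔ Dec u a a 1 := by
  constructor
  · intro h
    exact ⟨[a], by simpa using h, by simp⟩
  · rintro ⟨xs, h1, h2, _, h4⟩
    obtain ⟨x, rfl⟩ := List.length_eq_one_iff.1 h2
    have := h4 x (by simp)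
    have : x = a := le_antisymm this.2 this.1
    subst this
    simpa using h1

theorem dec_bump (u : List α) (i j : α) (m : ℕ) :
    Dec (bump [] u) i j (m + 1) ↔
      ∃ i', i' ∈ u ∧ (∀ c ∈ u, c < i → c ≤ i') ∧ Dec u i' j (m + 2) := by
  constructor
  · rintro ⟨ys, h1, h2, h3, h4⟩
    cases ys with
    | nil => simp at h2
    | cons y0 ys =>
      have hy0 : y0 ∈ u := by
        simpa using mem_bump (R := []) (by simp) (h1.subset (by simp : y0 ∈ y0 :: ys))
      have fin : ∀ i', i' ∈ u → i' ≤ y0 → ((∀ y ∈ y0 :: ys, i' < y) ∨ (∀ x ∈ u, i' ≤ x)) →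
          Dec u i' j (m + 2) := by
        intro i' hi' hiy hq
        obtain ⟨zs, hz1, hz2, hz3, hz4⟩ :=
          chain_bwd i' u [] ys y0 (by simp) h1 h3 (Or.inr hi') hq
        have hz1 : (y0 :: zs).Sublist u := by simpa using hz1
        have h0j := (h4 y0 (by simp)).2
        refine ⟨y0 :: zs, hz1, ?_, hz3, ?_⟩
        · simp at h2 ⊢; omega
        · intro x hx
          rcases List.mem_cons.1 hx with rfl | hx
          · exact ⟨hiy, h0j⟩
          · exact ⟨hz4 x hx, ((List.pairwise_cons.1 hz3).1 x hx).le.trans h0j⟩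
      by_cases hex : ∃ c ∈ u, c < i
      · obtain ⟨c, hc, hci⟩ := hex
        obtain ⟨i', hi', hmax⟩ := Finset.exists_max_image (u.toFinset.filter (· < i)) id
          ⟨c, by simp [hc, hci]⟩
        simp only [Finset.mem_filter, List.mem_toFinset, id] at hi' hmax
        exact ⟨i', hi'.1, fun c hc hci => hmax c ⟨hc, hci⟩,
          fin i' hi'.1 (hi'.2.le.trans (h4 y0 (by simp)).1)
            (Or.inl fun y hy => hi'.2.trans_le (h4 y hy).1)⟩
      · obtain ⟨i', hi', hmin⟩ := Finset.exists_min_image u.toFinset id ⟨y0, by simp [hy0]⟩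
        simp only [List.mem_toFinset, id] at hi' hmin
        exact ⟨i', hi', fun c hc hci => absurd ⟨c, hc, hci⟩ hex,
          fin i' hi' (hmin y0 hy0) (Or.inr hmin)⟩
  · rintro ⟨i', hi', hp, xs, h1, h2, h3, h4⟩
    cases xs with
    | nil => simp at h2
    | cons x0 xs =>
      obtain ⟨ys, e1, e2, e3, e4⟩ := chain_fwd' i' u [] xs x0 (by simp) h1 h3
        (fun x hx => (h4 x (List.mem_cons_of_mem _ hx)).1)
      refine ⟨ys, e1, ?_, e3, ?_⟩
      · simp at h2; omega
      · intro y hy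
        refine ⟨?_, (e4 y hy).1.trans (h4 x0 (by simp)).2⟩
        by_contra hlt
        have hyu : y ∈ u := by simpa using mem_bump (R := []) (by simp) (e1.subset hy)
        exact absurd (hp y hyu (not_le.1 hlt)) (not_le.2 (e4 y hy).2)

section Mon

variable {M : Type*} [Monoid M] {g : α → M}

theorem move_left
    (r2 : ∀ i j k, i < j → j < k → g j * g i * g k = g j * g k * g i)
    (a : α) : ∀ (H : List α) (b : α), a < b → (b :: H).Pairwise (· < ·) →
    g b * (H.map g).prod * g a = g b * g a * (H.map g).prod
  | [], b, _, _ => by simp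
  | h :: H, b, hab, hs => by
    rw [List.pairwise_cons] at hs
    have hbh : b < h := hs.1 h (by simp)
    have ih := move_left r2 a H h (hab.trans hbh) hs.2
    simp only [List.map_cons, List.prod_cons]
    calc g b * (g h * (H.map g).prod) * g a = g b * (g h * (H.map g).prod * g a) := by
          simp only [mul_assoc]
      _ = (g b * g h * g a) * (H.map g).prod := by rw [ih]; simp only [mul_assoc]
      _ = _ := by rw [← r2 a b h hab hbh]; simp only [mul_assoc]

theorem move_right
    (r3 : ∀ i j k, i < j → j < k → g i * g k * g j = g k * g i * g j)
    (b : α) : ∀ (L : List α) (a : α), a < b → (∀ x ∈ L, x < a) →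
    L.Pairwise (· < ·) →
    (L.map g).prod * g b * g a = g b * (L.map g).prod * g a := by
  intro L
  induction L using List.reverseRecOn with
  | nil => intros; simp
  | append_singleton L l ih =>
    intro a hab hL hs
    have hla : l < a := hL l (by simp)
    rw [List.pairwise_append] at hs
    have ih := ih l (hla.trans hab) (fun x hx => hs.2.2 x hx l (by simp)) hs.1
    simp only [List.map_append, List.prod_append, List.map_cons, List.map_nil, List.prod_cons,
      List.prod_nil, mul_one]
    calc (L.map g).prod * g l * g b * g a = (L.map g).prod * (g l * g b * g a) := by
          simp only [mul_assoc]
      _ = ((L.map g).prod * g b * g l) * g a := by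
          rw [r3 l a b hla hab]; simp only [mul_assoc]
      _ = _ := by rw [ih]; simp only [mul_assoc]

theorem ins_prod
    (r1 : ∀ i, g i * g i = g i)
    (r2 : ∀ i j k, i < j → j < k → g j * g i * g k = g j * g k * g i)
    (r3 : ∀ i j k, i < j → j < k → g i * g k * g j = g k * g i * g j)
    (r4 : ∀ i j, i < j → g j * g i * g i = g i * g j * g i)
    (r5 : ∀ i j, i < j → g j * g j * g i = g j * g i * g j)
    (a : α) (R : List α) (hR : R.Pairwise (· < ·)) :
    (R.map g).prod * g a =
      (((R.filter (fun x => decide (a < x))).head?.toList).map g).prod *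
        ((ins a R).map g).prod := by
  have hsplit := sorted_split (a := a) hR
  have hL : ∀ x ∈ R.filter (fun x => decide (x < a)), x < a := by
    intro x hx; simpa using (List.mem_filter.1 hx).2
  have hH : ∀ x ∈ R.filter (fun x => decide (a < x)), a < x := by
    intro x hx; simpa using (List.mem_filter.1 hx).2
  have hLs : (R.filter (fun x => decide (x < a))).Pairwise (· < ·) := hR.filter _
  have hHs : (R.filter (fun x => decide (a < x))).Pairwise (· < ·) := hR.filter _
  unfold ins
  have hprod : (R.map g).prod = ((R.filter (fun x => decide (x < a))).map g).prod *
      (((if a ∈ R then [a] else []).map g).prod *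
        ((R.filter (fun x => decide (a < x))).map g).prod) := by
    conv_lhs => rw [hsplit]
    simp only [List.map_append, List.prod_append]
  rw [hprod]
  generalize R.filter (fun x => decide (x < a)) = L at *
  generalize R.filter (fun x => decide (a < x)) = F at *
  cases F with
  | nil =>
    split_ifs
    · simp [mul_assoc, r1]
    · simp
  | cons b H =>
    have hab : a < b := hH b (by simp)
    have e1 := move_left r2 a H b hab hHs
    have e2 := move_right r3 b L a hab hL hLs
    have e3 : g b * g a = g b * g a * g b := by rw [← r5 a b hab, r1]
    have e4 : g a * (g b * g a) = g b * g a := by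
      rw [← mul_assoc, ← r4 a b hab, mul_assoc, r1]
    have e5 : ((if a ∈ R then [a] else []).map g).prod * (g b * g a) = g b * g a := by
      split_ifs
      · simpa using e4
      · simp
    generalize ((if a ∈ R then [a] else []).map g).prod = A at *
    simp only [List.head?_cons, Option.toList_some, List.map_cons, List.map_nil, List.prod_cons,
      List.prod_nil, mul_one, List.map_append, List.prod_append]
    calc (L.map g).prod * (A * (g b * (H.map g).prod)) * g a
        = (L.map g).prod * (A * (g b * (H.map g).prod * g a)) := by simp only [mul_assoc]
      _ = (L.map g).prod * (A * (g b * g a)) * (H.map g).prod := by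
          rw [e1]; simp only [mul_assoc]
      _ = (L.map g).prod * (g b * g a * g b) * (H.map g).prod := by rw [e5, ← e3]
      _ = ((L.map g).prod * g b * g a) * g b * (H.map g).prod := by simp only [mul_assoc]
      _ = _ := by rw [e2]; simp only [mul_assoc]

theorem bump_prod
    (r1 : ∀ i, g i * g i = g i)
    (r2 : ∀ i j k, i < j → j < k → g j * g i * g k = g j * g k * g i)
    (r3 : ∀ i j k, i < j → j < k → g i * g k * g j = g k * g i * g j)
    (r4 : ∀ i j, i < j → g j * g i * g i = g i * g j * g i)
    (r5 : ∀ i j, i < j → g j * g j * g i = g j * g i * g j)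
    : ∀ (u R : List α), R.Pairwise (· < ·) →
    (R.map g).prod * (u.map g).prod = ((bump R u).map g).prod * ((row R u).map g).prod
  | [], R, _ => by simp [bump, row]
  | a :: u, R, hR => by
    rw [bump, row, List.map_append, List.prod_append, mul_assoc,
      ← bump_prod r1 r2 r3 r4 r5 u (ins a R) (sorted_ins hR), ← mul_assoc, ← ins_prod r1 r2 r3 r4 r5 a R hR]
    simp [mul_assoc]

theorem prod_eq_of_dec
    (r1 : ∀ i, g i * g i = g i)
    (r2 : ∀ i j k, i < j → j < k → g j * g i * g k = g j * g k * g i)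
    (r3 : ∀ i j k, i < j → j < k → g i * g k * g j = g k * g i * g j)
    (r4 : ∀ i j, i < j → g j * g i * g i = g i * g j * g i)
    (r5 : ∀ i j, i < j → g j * g j * g i = g j * g i * g j)
    : ∀ (N : ℕ) (u v : List α), u.length ≤ N →
    (∀ i j m, Dec u i j m ↔ Dec v i j m) → (u.map g).prod = (v.map g).prod := by
  intro N
  induction N with
  | zero =>
    intro u v hu h
    have : u = [] := by simpa using hu
    subst this
    have : v = [] := by
      rw [List.eq_nil_iff_forall_not_mem]
      intro x hx
      rw [mem_iff_dec, ← h, ← mem_iff_dec] at hx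
      simp at hx
    rw [this]
  | succ N ih =>
    intro u v hu h
    have hmem : ∀ x, x ∈ u ↔ x ∈ v := fun x => by rw [mem_iff_dec, h, ← mem_iff_dec]
    have hrow : row [] u = row [] v := by
      apply List.Perm.eq_of_pairwise (le := (· < ·))
      · intro a b _ _ h1 h2
        exact absurd (h1.trans h2) (lt_irrefl _)
      · exact sorted_row (by simp)
      · exact sorted_row (by simp)
      · rw [List.perm_ext_iff_of_nodup]
        · intro x; simp [mem_row, hmem]
        · exact (sorted_row (by simp)).imp (fun h => h.ne)
        · exact (sorted_row (by simp)).imp (fun h => h.ne)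
    have eu := bump_prod r1 r2 r3 r4 r5 u [] (by simp)
    have ev := bump_prod r1 r2 r3 r4 r5 v [] (by simp)
    simp only [List.map_nil, List.prod_nil, one_mul] at eu ev
    rw [eu, ev, hrow]
    congr 1
    apply ih
    · cases u with
      | nil => simp [bump]
      | cons a u =>
        have := length_bump_lt a u
        omega
    · intro i j m
      cases m with
      | zero => exact iff_of_true (dec_zero _ _ _) (dec_zero _ _ _)
      | succ m =>
        rw [dec_bump, dec_bump]
        simp only [hmem, h]

end Mon

theorem sublist_flatMap {X β : Type*} (f : X → List β) : ∀ (L : List X) (s : List β),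
    s.Sublist (L.flatMap f) →
    ∃ t : List X, t.Sublist L ∧ t.length ≤ s.length ∧ s.Sublist (t.flatMap f)
  | [], s, h => ⟨[], by simpa using h⟩
  | x :: L, s, h => by
    rw [List.flatMap_cons, List.sublist_append_iff] at h
    obtain ⟨s1, s2, rfl, h1, h2⟩ := h
    obtain ⟨t, e1, e2, e3⟩ := sublist_flatMap f L s2 h2
    cases s1 with
    | nil => exact ⟨t, e1.cons _, by simpa using e2, by simpa using e3⟩
    | cons c s1 =>
      refine ⟨x :: t, e1.cons_cons _, by simp; omega, ?_⟩
      rw [List.flatMap_cons]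
      exact h1.append e3

theorem dec_of_sub {X : Type*} {n : ℕ} (f : X → List (Fin n)) (w w' : List X)
    (h : ∀ t : List X, t.length ≤ n → t.Sublist w → t.Sublist w') (i j : Fin n) (m : ℕ)
    (hd : Dec (w.flatMap f) i j m) : Dec (w'.flatMap f) i j m := by
  obtain ⟨xs, h1, h2, h3, h4⟩ := hd
  obtain ⟨t, e1, e2, e3⟩ := sublist_flatMap f w xs h1
  have hnd : xs.Nodup := h3.imp (fun h => ne_of_gt h)
  have hlen : xs.length ≤ n := by simpa using hnd.length_le_card
  exact ⟨xs, e3.trans ((h t (e2.trans hlen) e1).flatMap f), h2, h3, h4⟩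

end StylProof

/-- For `n ≥ 2`, if `w` and `w'` have the same set of scattered subwords (subsequences)
of length at most `n`, then the identity `w = w'` holds in the stylic monoid `Styl_n`. -/
theorem same_scattered_subwords_imp_stylic_identity (n : ℕ) (hn : 2 ≤ n) (X : Type*)
    (w w' : FreeMonoid X)
    (h : {u : List X | u.length ≤ n ∧ u.Sublist (FreeMonoid.toList w)} =
        {u : List X | u.length ≤ n ∧ u.Sublist (FreeMonoid.toList w')}) :
    ∀ φ : FreeMonoid X →* Styl n, φ w = φ w' := by
  intro φ
  let g : Fin n → Styl n := stylGen n
  have rel : ∀ u v, stylRel n u v →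
      PresentedMonoid.mk (stylRel n) u = PresentedMonoid.mk (stylRel n) v := by
    intro u v huv
    exact PresentedMonoid.mk_eq_mk_of_rel huv
  have hg : ∀ i, g i = PresentedMonoid.mk (stylRel n) (FreeMonoid.of i) := fun i => rfl
  have r1 : ∀ i, g i * g i = g i := by
    intro i
    simp only [hg, ← map_mul]
    exact rel _ _ (Or.inl ⟨i, rfl, rfl⟩)
  have r2 : ∀ i j k, i < j → j < k → g j * g i * g k = g j * g k * g i := by
    intro i j k h1 h2
    simp only [hg, ← map_mul]
    exact rel _ _ (Or.inr (Or.inl ⟨i, j, k, h1, h2, rfl, rfl⟩))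
  have r3 : ∀ i j k, i < j → j < k → g i * g k * g j = g k * g i * g j := by
    intro i j k h1 h2
    simp only [hg, ← map_mul]
    exact rel _ _ (Or.inr (Or.inr (Or.inl ⟨i, j, k, h1, h2, rfl, rfl⟩)))
  have r4 : ∀ i j, i < j → g j * g i * g i = g i * g j * g i := by
    intro i j h1
    simp only [hg, ← map_mul]
    exact rel _ _ (Or.inr (Or.inr (Or.inr (Or.inl ⟨i, j, h1, rfl, rfl⟩))))
  have r5 : ∀ i j, i < j → g j * g j * g i = g j * g i * g j := by
    intro i j h1
    simp only [hg, ← map_mul]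
    exact rel _ _ (Or.inr (Or.inr (Or.inr (Or.inr ⟨i, j, h1, rfl, rfl⟩))))
  have hmk : ∀ z : FreeMonoid (Fin n),
      PresentedMonoid.mk (stylRel n) z = ((FreeMonoid.toList z).map g).prod := by
    intro z
    induction z using FreeMonoid.inductionOn' with
    | one => simp
    | of_mul a z ih => simp [ih, hg]
  have hsurj : ∀ x : X, ∃ l : List (Fin n), φ (FreeMonoid.of x) = (l.map g).prod := by
    intro x
    obtain ⟨z, hz⟩ := PresentedMonoid.surjective_mk (φ (FreeMonoid.of x))
    exact ⟨FreeMonoid.toList z, by rw [← hz, hmk]⟩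
  choose f hf using hsurj
  have hφ : ∀ z : FreeMonoid X, φ z = (((FreeMonoid.toList z).flatMap f).map g).prod := by
    intro z
    induction z using FreeMonoid.inductionOn' with
    | one => simp
    | of_mul a z ih => simp [ih, hf]
  rw [hφ, hφ]
  apply StylProof.prod_eq_of_dec r1 r2 r3 r4 r5 _ _ _ le_rfl
  intro i j m
  constructor
  · apply StylProof.dec_of_sub
    intro t ht hs
    exact ((Set.ext_iff.1 h t).1 ⟨ht, hs⟩).2
  · apply StylProof.dec_of_sub
    intro t ht hs
    exact ((Set.ext_iff.1 h t).2 ⟨ht, hs⟩).2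
end
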